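/- (Extinction in the absence of traveling waves.) Assume (H1), (EXP) and (H2), and let c≥0. Suppose there is no bounded positive traveling-wave profile. Then for every bounded classical solution v of (E) on [0,∞) with v(0,ξ) ≥ 0 for all ξ∈ℝ, one has lim_{t→∞} v(t,ξ) = 0 uniformly for ξ in compact subsets of ℝ. -/

import Mathlib

open MeasureTheory Real Set Filter Topology

noncomputable section

/-- Hypothesis (H1) on the kernel `k`. -/
def H1 (k : ℝ → ℝ) : Prop :=
  ContDiff ℝ 1 k ∧ (∀ z, 0 ≤ k z) ∧ (∀ z, k (-z) = k z) ∧
  (∫ z, k z) = 1 ∧ 0 < k 0 ∧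
  ∃ μ M : ℝ, 0 < μ ∧ 0 < M ∧ ∀ z, M < |z| →
    k z < Real.exp (-(μ * |z|)) ∧ |deriv k z| < Real.exp (-(μ * |z|))

/-- Hypothesis (EXP): all exponential moments of `k` are finite. -/
def EXPk (k : ℝ → ℝ) : Prop :=
  ∀ μ : ℝ, MeasureTheory.Integrable (fun z => Real.exp (μ * z) * k z)

/-- Hypothesis (H2) on the cut-off function `χ`. -/
def IsH2chi (r q L L0 : ℝ) (χ : ℝ → ℝ) : Prop :=
  0 < r ∧ 0 < q ∧ 0 < L ∧ 0 < L0 ∧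
  ContDiff ℝ 1 χ ∧ (∀ x, χ x ∈ Set.Icc (0:ℝ) 1) ∧
  (∀ x, χ (-x) = χ x) ∧ (∀ x, |x| ≤ L → χ x = 1) ∧
  (∀ x, L + L0 ≤ |x| → χ x = 0) ∧ AntitoneOn χ (Set.Ici 0)

/-- The growth function of hypothesis (H2). -/
def fH2 (r q : ℝ) (χ : ℝ → ℝ) : ℝ → ℝ → ℝ :=
  fun x u => -q + (r * (1 - u) + q) * χ x

/-- A bounded positive traveling-wave profile for speed `c`, kernel `k`, growth `f`. -/
def IsTW (c : ℝ) (k : ℝ → ℝ) (f : ℝ → ℝ → ℝ) (Φ : ℝ → ℝ) : Prop :=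
  ContDiff ℝ 1 Φ ∧ (∀ ξ, 0 < Φ ξ) ∧ (∃ C, ∀ ξ, Φ ξ ≤ C) ∧
  ∀ ξ, c * deriv Φ ξ + ((∫ η, k (η - ξ) * Φ η) - Φ ξ) + f ξ (Φ ξ) * Φ ξ = 0

/-- A bounded classical solution of equation (E) on `[0,∞) × ℝ`, with partial
derivatives `vt` (in time) and `vx` (in space). -/
def IsClassicalSol (c : ℝ) (k : ℝ → ℝ) (f : ℝ → ℝ → ℝ) (v vt vx : ℝ → ℝ → ℝ) : Prop :=
  (∃ C, ∀ t ξ, 0 ≤ t → |v t ξ| ≤ C) ∧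
  ContinuousOn (fun p : ℝ × ℝ => v p.1 p.2) {p : ℝ × ℝ | 0 ≤ p.1} ∧
  ContinuousOn (fun p : ℝ × ℝ => vt p.1 p.2) {p : ℝ × ℝ | 0 ≤ p.1} ∧
  ContinuousOn (fun p : ℝ × ℝ => vx p.1 p.2) {p : ℝ × ℝ | 0 ≤ p.1} ∧
  (∀ t ξ, 0 ≤ t → HasDerivWithinAt (fun s => v s ξ) (vt t ξ) (Set.Ici 0) t) ∧
  (∀ t ξ, 0 ≤ t → HasDerivAt (fun y => v t y) (vx t ξ) ξ) ∧
  (∀ t ξ, 0 ≤ t →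
    vt t ξ = c * vx t ξ + ((∫ η, k (η - ξ) * v t η) - v t ξ) + f ξ (v t ξ) * v t ξ)

/-- The spreading speed `c*` of the homogeneous equation with growth rate `r`. -/
def cstar (k : ℝ → ℝ) (r : ℝ) : ℝ :=
  sInf {y : ℝ | ∃ μ : ℝ, 0 < μ ∧ y = ((∫ z, Real.exp (-(μ * z)) * k z) - 1 + r) / μ}

structure St (k χ : ℝ → ℝ) (r q M : ℝ) : Prop where
  kc : Continuous k
  kn : ∀ z, 0 ≤ k z
  ki : Integrable k
  k1 : ∫ z, k z = 1
  k0 : 0 < k 0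
  kd : ∀ z, HasDerivAt k (deriv k z) z
  kdc : Continuous (deriv k)
  kb : ∃ C μ : ℝ, 0 < μ ∧ ∀ z, |deriv k z| ≤ C * Real.exp (-(μ * |z|))
  xc : ContDiff ℝ 1 χ
  x0 : ∀ x, 0 ≤ χ x
  x1 : ∀ x, χ x ≤ 1
  r0 : 0 < r
  q0 : 0 < q
  M1 : 1 ≤ M

structure Adm (M : ℝ) (φ : ℝ → ℝ) : Prop where
  me : Measurable φ
  lo : ∀ x, 0 ≤ φ x
  hi : ∀ x, φ x ≤ M

def lam (r q M : ℝ) : ℝ := 1 + q + 2 * r * M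

def gg (r q M : ℝ) (χ : ℝ → ℝ) (x u : ℝ) : ℝ := (lam r q M - 1 + fH2 r q χ x u) * u

def Kc (k φ : ℝ → ℝ) (ξ : ℝ) : ℝ := ∫ η, k (η - ξ) * φ η

def GG (k χ : ℝ → ℝ) (r q M : ℝ) (φ : ℝ → ℝ) (x : ℝ) : ℝ := Kc k φ x + gg r q M χ x (φ x)

def TT (k χ : ℝ → ℝ) (r q M c : ℝ) (φ : ℝ → ℝ) (ξ : ℝ) : ℝ :=
  ∫ τ in Ioi (0:ℝ), Real.exp (-lam r q M * τ) * GG k χ r q M φ (ξ + c * τ)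

lemma integrable_exp_abs {μ : ℝ} (hμ : 0 < μ) : Integrable (fun z : ℝ => Real.exp (-(μ * |z|))) := by
  rw [← integrableOn_univ, ← Iic_union_Ioi (a := (0:ℝ))]
  apply IntegrableOn.union
  · have := integrableOn_exp_mul_Iic hμ 0
    refine this.congr_fun (fun x hx => ?_) measurableSet_Iic
    simp only [mem_Iic] at hx
    simp [abs_of_nonpos hx]
  · have := integrableOn_exp_mul_Ioi (neg_lt_zero.2 hμ) 0
    refine this.congr_fun (fun x hx => ?_) measurableSet_Ioi
    simp only [mem_Ioi] at hx
    simp [abs_of_pos hx]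

lemma st_of (k χ : ℝ → ℝ) (r q L L0 M : ℝ) (hk : H1 k) (hχ : IsH2chi r q L L0 χ) (hM : 1 ≤ M) :
    St k χ r q M := by
  obtain ⟨h1, h2, h3, h4, h5, μ, R, hμ, hR, hb⟩ := hk
  obtain ⟨a1, a2, a3, a4, a5, a6, a7, a8, a9, a10⟩ := hχ
  have hdc : Continuous (deriv k) := h1.continuous_deriv le_rfl
  refine ⟨h1.continuous, h2, ?_, h4, h5,
    fun z => (h1.differentiable (by norm_num) z).hasDerivAt, hdc, ?_, a5,
    fun x => (a6 x).1, fun x => (a6 x).2, a1, a2, hM⟩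
  · by_contra h
    rw [integral_undef h] at h4
    norm_num at h4
  · obtain ⟨C, hC⟩ := (isCompact_Icc (a := -R) (b := R)).exists_bound_of_continuousOn hdc.continuousOn
    refine ⟨max 1 (C * Real.exp (μ * R)), μ, hμ, fun z => ?_⟩
    rcases le_or_gt |z| R with h | h
    · have h' := hC z (abs_le.1 h)
      rw [Real.norm_eq_abs] at h'
      calc |deriv k z| ≤ C := h'
        _ = C * Real.exp (μ * R) * Real.exp (-(μ * R)) := by
            rw [mul_assoc, ← Real.exp_add]; simp
        _ ≤ C * Real.exp (μ * R) * Real.exp (-(μ * |z|)) := by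
            have : 0 ≤ C := (abs_nonneg _).trans h'
            gcongr
        _ ≤ _ := by gcongr; exact le_max_right _ _
    · calc |deriv k z| ≤ 1 * Real.exp (-(μ * |z|)) := by simpa using (hb z h).2.le
        _ ≤ _ := by gcongr; exact le_max_left _ _

section
variable {k χ : ℝ → ℝ} {r q M c : ℝ}

lemma lam_pos (S : St k χ r q M) : 0 < lam r q M := by
  have := S.r0; have := S.q0; have := S.M1; unfold lam; positivity

lemma gg_sub (x u w : ℝ) : gg r q M χ x w - gg r q M χ x u
    = (w - u) * (2 * r * M + (r + q) * χ x - r * χ x * (u + w)) := by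
  simp only [gg, fH2, lam]; ring

lemma gg_mono (S : St k χ r q M) {x u w : ℝ} (hu : 0 ≤ u) (huw : u ≤ w) (hw : w ≤ M) :
    gg r q M χ x u ≤ gg r q M χ x w := by
  have h := gg_sub (r := r) (q := q) (M := M) (χ := χ) x u w
  have h1 : 0 ≤ 2 * r * M + (r + q) * χ x - r * χ x * (u + w) := by
    have e1 : r * χ x * (u + w) ≤ r * 1 * (M + M) := by
      have := S.r0; have := S.x0 x; have := S.x1 x
      have : u ≤ M := huw.trans hw
      have : 0 ≤ u + w := by linarith
      gcongr
    have e2 : 0 ≤ (r + q) * χ x := mul_nonneg (by linarith [S.r0, S.q0]) (S.x0 x)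
    linarith
  have := mul_nonneg (sub_nonneg.2 huw) h1
  linarith

lemma gg_nonneg (S : St k χ r q M) {x u : ℝ} (hu : 0 ≤ u) (hw : u ≤ M) :
    0 ≤ gg r q M χ x u := by
  have := gg_mono (x := x) S le_rfl hu hw
  simpa [gg] using this

lemma gg_le (S : St k χ r q M) {x u : ℝ} (hu : 0 ≤ u) (hw : u ≤ M) :
    gg r q M χ x u ≤ (lam r q M - 1) * M := by
  refine (gg_mono S hu hw le_rfl).trans ?_
  unfold gg
  have : fH2 r q χ x M ≤ 0 := by
    unfold fH2
    have h1 := S.r0; have := S.q0; have h2 := S.x0 x; have := S.x1 x; have h3 := S.M1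
    have := mul_nonneg (mul_nonneg h1.le h2) (sub_nonneg.2 h3)
    nlinarith
  have := S.M1
  gcongr; linarith

lemma gg_lip (S : St k χ r q M) {x u w : ℝ} (hu : 0 ≤ u) (hu' : u ≤ M) (hw0 : 0 ≤ w) (hw : w ≤ M) :
    gg r q M χ x w - gg r q M χ x u ≤ (lam r q M + r) * max (w - u) 0 := by
  rcases le_total w u with h | h
  · have := gg_mono (x := x) S hw0 h hu'
    rw [max_eq_right (by linarith)]; linarith
  · rw [max_eq_left (by linarith), gg_sub x, mul_comm]
    have h0 : 0 ≤ r * χ x * (u + w) :=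
      mul_nonneg (mul_nonneg S.r0.le (S.x0 x)) (by linarith)
    have h1 : (r + q) * χ x ≤ (r + q) * 1 := by
      have := S.r0; have := S.q0; have := S.x1 x; gcongr
    apply mul_le_mul_of_nonneg_right _ (by linarith)
    unfold lam; linarith

lemma gg_x (S : St k χ r q M) {x y u : ℝ} (hu : 0 ≤ u) (hw : u ≤ M) :
    gg r q M χ y u - gg r q M χ x u ≤ ((r * (1 + M) + q) * M) * |χ y - χ x| := by
  have : gg r q M χ y u - gg r q M χ x u = ((r * (1 - u) + q) * u) * (χ y - χ x) := by
    simp only [gg, fH2]; ring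
  rw [this]
  refine (le_abs_self _).trans ?_
  rw [abs_mul, abs_mul]
  have := S.r0; have := S.q0; have := S.M1
  have h1 : |r * (1 - u) + q| ≤ r * (1 + M) + q := by
    rw [abs_le]; constructor <;> nlinarith
  have h2 : |u| ≤ M := by rw [abs_of_nonneg hu]; exact hw
  gcongr

lemma Kc_eq (φ : ℝ → ℝ) (ξ : ℝ) : Kc k φ ξ = ∫ z, k z * φ (ξ + z) := by
  unfold Kc
  rw [← integral_add_left_eq_self _ ξ]
  simp

lemma kint (S : St k χ r q M) {φ : ℝ → ℝ} (hφ : Measurable φ) {B : ℝ} (hB : ∀ x, |φ x| ≤ B) (ξ : ℝ) :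
    Integrable (fun z => k z * φ (ξ + z)) := by
  refine S.ki.mul_bdd (c := B) ?_ (ae_of_all _ fun z => by simpa using hB _)
  exact (hφ.comp (measurable_const_add ξ)).aestronglyMeasurable

lemma Adm.ab {φ : ℝ → ℝ} (h : Adm M φ) (x : ℝ) : |φ x| ≤ M := by
  rw [abs_of_nonneg (h.lo x)]; exact h.hi x

lemma Kc_nonneg (S : St k χ r q M) {φ : ℝ → ℝ} (h : ∀ x, 0 ≤ φ x) (x : ℝ) : 0 ≤ Kc k φ x :=
  integral_nonneg fun z => mul_nonneg (S.kn _) (h _)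

lemma Kc_mono (S : St k χ r q M) {φ ψ : ℝ → ℝ} (h : Adm M φ) (h' : Adm M ψ) (hh : ∀ x, φ x ≤ ψ x)
    (x : ℝ) : Kc k φ x ≤ Kc k ψ x := by
  rw [Kc_eq, Kc_eq]
  exact integral_mono (kint S h.me h.ab x) (kint S h'.me h'.ab x)
    fun z => mul_le_mul_of_nonneg_left (hh _) (S.kn _)

lemma Kc_le (S : St k χ r q M) {φ : ℝ → ℝ} (h : Adm M φ) (x : ℝ) : Kc k φ x ≤ M := by
  rw [Kc_eq]
  calc _ ≤ ∫ z, k z * M := integral_mono (kint S h.me h.ab x) (S.ki.mul_const M)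
          fun z => mul_le_mul_of_nonneg_left (h.hi _) (S.kn _)
    _ = M := by rw [integral_mul_const, S.k1, one_mul]

lemma dbound (S : St k χ r q M) : ∃ b : ℝ → ℝ, Integrable b ∧ ∀ η x, |x| ≤ 1 →
    |deriv k (η - x)| ≤ b η := by
  obtain ⟨C, μ, hμ, hb⟩ := S.kb
  refine ⟨fun η => C * Real.exp μ * Real.exp (-(μ * |η|)), (integrable_exp_abs hμ).const_mul _, ?_⟩
  intro η x hx
  refine (hb _).trans ?_
  have hC : 0 ≤ C := by
    have := (abs_nonneg _).trans (hb 0); simpa using this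
  change _ ≤ C * Real.exp μ * Real.exp (-(μ * |η|))
  rw [mul_assoc, ← Real.exp_add]
  gcongr
  have : |η| ≤ |η - x| + |x| := by simpa using abs_add_le (η - x) x
  nlinarith

lemma Kc_deriv (S : St k χ r q M) {φ : ℝ → ℝ} (h : Adm M φ) (ξ : ℝ) :
    HasDerivAt (Kc k φ) (∫ η, -deriv k (η - ξ) * φ η) ξ := by
  obtain ⟨b, hb, hb'⟩ := dbound S
  refine (hasDerivAt_integral_of_dominated_loc_of_deriv_le (F := fun ξ η => k (η - ξ) * φ η)
    (F' := fun ξ η => -deriv k (η - ξ) * φ η) (bound := fun η => b (η - ξ) * M)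
    (Metric.closedBall_mem_nhds ξ one_pos) ?_ ?_ ?_ ?_ ?_ ?_).2
  · refine Eventually.of_forall fun x => ?_
    exact ((S.kc.measurable.comp (measurable_id.sub_const x)).mul h.me).aestronglyMeasurable
  · have := (kint S h.me h.ab ξ).comp_sub_right ξ
    simpa using this
  · exact ((S.kdc.measurable.comp (measurable_id.sub_const ξ)).neg.mul h.me).aestronglyMeasurable
  · refine ae_of_all _ fun η x hx => ?_
    rw [norm_mul, norm_neg, Real.norm_eq_abs, Real.norm_eq_abs]
    have hx' : |x - ξ| ≤ 1 := by simpa [Real.dist_eq] using hx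
    have := hb' (η - ξ) (x - ξ) hx'
    simp only [sub_sub_sub_cancel_right] at this
    exact mul_le_mul this (h.ab _) (abs_nonneg _) ((abs_nonneg _).trans this)
  · exact (hb.comp_sub_right ξ).mul_const M
  · refine ae_of_all _ fun η x hx => ?_
    have h1 : HasDerivAt (fun x => η - x) (-1) x := by simpa using (hasDerivAt_id x).const_sub η
    have := ((S.kd (η - x)).comp x h1).mul_const (φ η)
    simpa using this

lemma Kc_contDiff (S : St k χ r q M) {φ : ℝ → ℝ} (h : Adm M φ) : ContDiff ℝ 1 (Kc k φ) := by
  rw [contDiff_one_iff_deriv]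
  refine ⟨fun ξ => (Kc_deriv S h ξ).differentiableAt, ?_⟩
  have : deriv (Kc k φ) = fun ξ => ∫ η, -deriv k (η - ξ) * φ η :=
    funext fun ξ => (Kc_deriv S h ξ).deriv
  rw [this, continuous_iff_continuousAt]
  intro ξ
  obtain ⟨b, hb, hb'⟩ := dbound S
  refine tendsto_integral_filter_of_dominated_convergence (fun η => b (η - ξ) * M) ?_ ?_ ?_ ?_
  · refine Eventually.of_forall fun x => ?_
    exact ((S.kdc.measurable.comp (measurable_id.sub_const x)).neg.mul h.me).aestronglyMeasurable
  · filter_upwards [Metric.closedBall_mem_nhds ξ one_pos] with x hx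
    refine ae_of_all _ fun η => ?_
    rw [norm_mul, norm_neg, Real.norm_eq_abs, Real.norm_eq_abs]
    have hx' : |x - ξ| ≤ 1 := by simpa [Real.dist_eq] using hx
    have := hb' (η - ξ) (x - ξ) hx'
    simp only [sub_sub_sub_cancel_right] at this
    exact mul_le_mul this (h.ab _) (abs_nonneg _) ((abs_nonneg _).trans this)
  · exact (hb.comp_sub_right ξ).mul_const M
  · refine ae_of_all _ fun η => ?_
    have : Continuous fun x => -deriv k (η - x) * φ η :=
      ((S.kdc.comp (continuous_const.sub continuous_id)).neg).mul_const _
    exact this.tendsto ξ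

lemma GG_nonneg (S : St k χ r q M) {φ : ℝ → ℝ} (h : Adm M φ) (x : ℝ) : 0 ≤ GG k χ r q M φ x :=
  add_nonneg (Kc_nonneg S h.lo x) (gg_nonneg S (h.lo x) (h.hi x))

lemma GG_le (S : St k χ r q M) {φ : ℝ → ℝ} (h : Adm M φ) (x : ℝ) :
    GG k χ r q M φ x ≤ lam r q M * M := by
  have h1 := Kc_le S h x
  have h2 := gg_le (x := x) S (h.lo x) (h.hi x)
  unfold GG; linarith

lemma GG_mono (S : St k χ r q M) {φ ψ : ℝ → ℝ} (h : Adm M φ) (h' : Adm M ψ) (hh : ∀ x, φ x ≤ ψ x)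
    (x : ℝ) : GG k χ r q M φ x ≤ GG k χ r q M ψ x :=
  add_le_add (Kc_mono S h h' hh x) (gg_mono S (h.lo x) (hh x) (h'.hi x))

lemma gg_meas (S : St k χ r q M) {φ : ℝ → ℝ} (h : Measurable φ) :
    Measurable (fun x => gg r q M χ x (φ x)) := by
  have := S.xc.continuous.measurable
  unfold gg fH2
  fun_prop

lemma GG_meas (S : St k χ r q M) {φ : ℝ → ℝ} (h : Adm M φ) : Measurable (GG k χ r q M φ) :=
  (Kc_contDiff S h).continuous.measurable.add (gg_meas S h.me)

lemma exp_int (S : St k χ r q M) :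
    IntegrableOn (fun τ => Real.exp (-lam r q M * τ)) (Ioi (0:ℝ)) :=
  exp_neg_integrableOn_Ioi 0 (lam_pos S)

lemma TT_int (S : St k χ r q M) {φ : ℝ → ℝ} (h : Adm M φ) (ξ : ℝ) :
    IntegrableOn (fun τ => Real.exp (-lam r q M * τ) * GG k χ r q M φ (ξ + c * τ)) (Ioi (0:ℝ)) := by
  refine Integrable.mul_bdd (c := lam r q M * M) (exp_int S) ?_ (ae_of_all _ fun z => ?_)
  · exact ((GG_meas S h).comp (by fun_prop)).aestronglyMeasurable
  · rw [Real.norm_eq_abs, abs_of_nonneg (GG_nonneg S h _)]; exact GG_le S h _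

lemma TT_adm (S : St k χ r q M) {φ : ℝ → ℝ} (h : Adm M φ) : Adm M (TT k χ r q M c φ) := by
  refine ⟨?_, fun x => ?_, fun x => ?_⟩
  · have h1 : Measurable (Function.uncurry fun (ξ τ : ℝ) =>
        Real.exp (-lam r q M * τ) * GG k χ r q M φ (ξ + c * τ)) := by
      have := GG_meas S h
      unfold Function.uncurry
      fun_prop
    exact (h1.stronglyMeasurable.integral_prod_right).measurable
  · exact integral_nonneg fun τ => mul_nonneg (Real.exp_pos _).le (GG_nonneg S h _)
  · have hl := lam_pos S
    calc TT k χ r q M c φ x ≤ ∫ τ in Ioi (0:ℝ), Real.exp (-lam r q M * τ) * (lam r q M * M) := by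
          refine integral_mono (TT_int S h x) ((exp_int S).mul_const _) fun τ => ?_
          exact mul_le_mul_of_nonneg_left (GG_le S h _) (Real.exp_pos _).le
      _ = M := by
          rw [integral_mul_const, integral_exp_mul_Ioi (neg_lt_zero.2 hl)]
          simp; field_simp

lemma TT_mono (S : St k χ r q M) {φ ψ : ℝ → ℝ} (h : Adm M φ) (h' : Adm M ψ) (hh : ∀ x, φ x ≤ ψ x)
    (x : ℝ) : TT k χ r q M c φ x ≤ TT k χ r q M c ψ x :=
  integral_mono (TT_int S h x) (TT_int S h' x) fun τ =>
    mul_le_mul_of_nonneg_left (GG_mono S h h' hh _) (Real.exp_pos _).le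

def Ph (k χ : ℝ → ℝ) (r q M c : ℝ) : ℕ → ℝ → ℝ
  | 0 => fun _ => M
  | n + 1 => TT k χ r q M c (Ph k χ r q M c n)

lemma Ph_adm (S : St k χ r q M) (n : ℕ) : Adm M (Ph k χ r q M c n) := by
  induction n with
  | zero => exact ⟨measurable_const, fun _ => zero_le_one.trans S.M1, fun _ => le_rfl⟩
  | succ n ih => exact TT_adm S ih

lemma Ph_anti (S : St k χ r q M) (x : ℝ) : Antitone (fun n => Ph k χ r q M c n x) := by
  refine antitone_nat_of_succ_le fun n => ?_
  induction n generalizing x with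
  | zero => exact (TT_adm S (Ph_adm S 0)).hi x
  | succ n ih => exact TT_mono S (Ph_adm S (n+1)) (Ph_adm S n) ih x

def Pi0 (k χ : ℝ → ℝ) (r q M c : ℝ) (x : ℝ) : ℝ := ⨅ n, Ph k χ r q M c n x

lemma Pi0_tend (S : St k χ r q M) (x : ℝ) :
    Tendsto (fun n => Ph k χ r q M c n x) atTop (𝓝 (Pi0 k χ r q M c x)) :=
  tendsto_atTop_ciInf (Ph_anti S x) ⟨0, by rintro _ ⟨n, rfl⟩; exact (Ph_adm S n).lo x⟩

lemma Pi0_adm (S : St k χ r q M) : Adm M (Pi0 k χ r q M c) := by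
  refine ⟨?_, fun x => ?_, fun x => ?_⟩
  · exact measurable_of_tendsto_metrizable (fun n => (Ph_adm S n).me)
      (tendsto_pi_nhds.2 fun x => Pi0_tend S x)
  · exact ge_of_tendsto' (Pi0_tend S x) fun n => (Ph_adm S n).lo x
  · exact le_of_tendsto' (Pi0_tend S x) fun n => (Ph_adm S n).hi x

lemma GG_tend (S : St k χ r q M) (x : ℝ) :
    Tendsto (fun n => GG k χ r q M (Ph k χ r q M c n) x) atTop
      (𝓝 (GG k χ r q M (Pi0 k χ r q M c) x)) := by
  unfold GG
  refine Tendsto.add ?_ ?_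
  · simp only [Kc_eq]
    refine tendsto_integral_of_dominated_convergence (fun z => k z * M) (fun n => ?_)
      (S.ki.mul_const M) (fun n => ae_of_all _ fun z => ?_) (ae_of_all _ fun z => ?_)
    · exact (kint S (Ph_adm S n).me (Ph_adm S n).ab x).aestronglyMeasurable
    · rw [norm_mul, Real.norm_eq_abs, Real.norm_eq_abs, abs_of_nonneg (S.kn z)]
      exact mul_le_mul_of_nonneg_left ((Ph_adm S n).ab _) (S.kn z)
    · exact (Pi0_tend S _).const_mul _
  · have : Continuous (fun u => gg r q M χ x u) := by unfold gg fH2; fun_prop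
    exact (this.tendsto _).comp (Pi0_tend S x)

lemma Pi0_fix (S : St k χ r q M) (x : ℝ) :
    TT k χ r q M c (Pi0 k χ r q M c) x = Pi0 k χ r q M c x := by
  have h1 := (tendsto_add_atTop_iff_nat 1).2 (Pi0_tend (c := c) S x)
  refine tendsto_nhds_unique ?_ h1
  change Tendsto (fun n => TT k χ r q M c (Ph k χ r q M c n) x) atTop _
  unfold TT
  refine tendsto_integral_of_dominated_convergence
    (fun τ => Real.exp (-lam r q M * τ) * (lam r q M * M)) (fun n => ?_)
    ((exp_int S).mul_const _) (fun n => ae_of_all _ fun z => ?_) (ae_of_all _ fun z => ?_)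
  · exact (TT_int S (Ph_adm S n) x).aestronglyMeasurable
  · rw [norm_mul, Real.norm_eq_abs, Real.norm_eq_abs, abs_of_nonneg (Real.exp_pos _).le,
      abs_of_nonneg (GG_nonneg S (Ph_adm S n) _)]
    exact mul_le_mul_of_nonneg_left (GG_le S (Ph_adm S n) _) (Real.exp_pos _).le
  · exact (GG_tend S _).const_mul _

end
section
variable {k χ : ℝ → ℝ} {r q M c : ℝ}

lemma ex_of_ae {U : Set ℝ} (hU : IsOpen U) (hne : U.Nonempty) {P : ℝ → Prop}
    (h : ∀ᵐ x, x ∈ U → P x) : ∃ x ∈ U, P x := by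
  by_contra hcon
  push Not at hcon
  have h1 : U ⊆ {x | ¬ (x ∈ U → P x)} := fun x hx hh => hcon x hx (hh hx)
  have h2 := measure_mono_null h1 (ae_iff.1 h)
  exact (hU.measure_pos volume hne).ne' h2

lemma Kc_zero_of (S : St k χ r q M) {Φ : ℝ → ℝ} (h : Adm M Φ)
    (hfix : ∀ x, TT k χ r q M c Φ x = Φ x) {x : ℝ} (hx : Φ x = 0) : Kc k Φ x = 0 := by
  by_contra hne
  have hpos : 0 < Kc k Φ x := lt_of_le_of_ne (Kc_nonneg S h.lo x) (Ne.symm hne)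
  have h0 : TT k χ r q M c Φ x = 0 := (hfix x).trans hx
  unfold TT at h0
  rw [setIntegral_eq_zero_iff_of_nonneg_ae (ae_of_all _ fun τ =>
    mul_nonneg (Real.exp_pos _).le (GG_nonneg S h _)) (TT_int S h x)] at h0
  have h1 := (ae_restrict_iff' measurableSet_Ioi).1 h0
  have hc : Continuous fun τ : ℝ => Kc k Φ (x + c * τ) :=
    (Kc_contDiff S h).continuous.comp (by fun_prop)
  have hopen : IsOpen {τ : ℝ | 0 < Kc k Φ (x + c * τ)} := isOpen_lt continuous_const hc
  have hmem : {τ : ℝ | 0 < Kc k Φ (x + c * τ)} ∈ 𝓝 (0:ℝ) := hopen.mem_nhds (by simpa using hpos)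
  obtain ⟨ε, hε, hb⟩ := Metric.mem_nhds_iff.1 hmem
  obtain ⟨τ, hτ, h2⟩ := ex_of_ae (U := Ioo 0 ε) isOpen_Ioo ⟨ε/2, by simp [hε]⟩
    (P := fun τ => Real.exp (-lam r q M * τ) * GG k χ r q M Φ (x + c * τ) = 0)
    (by filter_upwards [h1] with τ h hτ using h hτ.1)
  have h3 : 0 < Kc k Φ (x + c * τ) := hb (by
    rw [Metric.mem_ball, Real.dist_eq, sub_zero, abs_of_pos hτ.1]; exact hτ.2)
  have h4 : 0 < GG k χ r q M Φ (x + c * τ) :=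
    add_pos_of_pos_of_nonneg h3 (gg_nonneg S (h.lo _) (h.hi _))
  exact (mul_pos (Real.exp_pos _) h4).ne' h2

lemma kdelta (S : St k χ r q M) : ∃ δ > 0, ∀ z, |z| < δ → 0 < k z := by
  have hopen : IsOpen {z : ℝ | 0 < k z} := isOpen_lt continuous_const S.kc
  obtain ⟨ε, hε, hb⟩ := Metric.mem_nhds_iff.1 (hopen.mem_nhds (show (0:ℝ) ∈ _ from S.k0))
  exact ⟨ε, hε, fun z hz => hb (by simpa using hz)⟩

lemma ae_zero_of (S : St k χ r q M) {Φ : ℝ → ℝ} (h : Adm M Φ) {δ : ℝ}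
    (hδ : ∀ z, |z| < δ → 0 < k z) {x : ℝ} (hx : Kc k Φ x = 0) :
    ∀ᵐ η, η ∈ Metric.ball x δ → Φ η = 0 := by
  unfold Kc at hx
  have hi : Integrable fun η => k (η - x) * Φ η := by
    have := (kint S h.me h.ab x).comp_sub_right x
    simpa using this
  rw [integral_eq_zero_iff_of_nonneg (fun η => mul_nonneg (S.kn _) (h.lo _)) hi] at hx
  filter_upwards [hx] with η hη hb
  have : 0 < k (η - x) := hδ _ (by simpa [Real.dist_eq] using hb)
  exact (mul_eq_zero.1 hη).resolve_left this.ne'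

lemma all_zero (S : St k χ r q M) {Φ : ℝ → ℝ} (h : Adm M Φ)
    (hfix : ∀ x, TT k χ r q M c Φ x = Φ x) {x₀ : ℝ} (hx : Kc k Φ x₀ = 0) :
    (∀ x, Kc k Φ x = 0) ∧ ∀ᵐ x, Φ x = 0 := by
  obtain ⟨δ, hδ, hk⟩ := kdelta S
  have hcl : IsClosed {x | Kc k Φ x = 0} :=
    isClosed_eq (Kc_contDiff S h).continuous continuous_const
  have hop : IsOpen {x | Kc k Φ x = 0} := by
    rw [Metric.isOpen_iff]
    intro x hx
    refine ⟨δ, hδ, fun y hy => ?_⟩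
    rw [← hcl.closure_eq, _root_.mem_closure_iff]
    intro O hO hyO
    obtain ⟨z, hz, hz0⟩ := ex_of_ae (hO.inter Metric.isOpen_ball) ⟨y, hyO, hy⟩
      (P := fun z => Φ z = 0) (by filter_upwards [ae_zero_of S h hk hx] with z h1 h2 using h1 h2.2)
    exact ⟨z, hz.1, Kc_zero_of S h hfix hz0⟩
  have huniv : {x | Kc k Φ x = 0} = univ := IsClopen.eq_univ ⟨hcl, hop⟩ ⟨x₀, hx⟩
  have hall : ∀ x, Kc k Φ x = 0 := fun x => by
    have : x ∈ {x | Kc k Φ x = 0} := huniv ▸ mem_univ x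
    exact this
  refine ⟨hall, ?_⟩
  rw [ae_iff]
  refine measure_null_of_locally_null _ fun x _ => ?_
  refine ⟨{a | ¬ Φ a = 0} ∩ Metric.ball x δ,
    inter_mem_nhdsWithin _ (Metric.ball_mem_nhds x hδ), ?_⟩
  refine measure_mono_null ?_ (ae_iff.1 (ae_zero_of S h hk (hall x)))
  rintro y ⟨h1, h2⟩ h3
  exact h1 (h3 h2)

lemma ioi_form {l : ℝ} (hc : 0 < c) (H : ℝ → ℝ) (x : ℝ) :
    ∫ τ in Ioi (0:ℝ), Real.exp (-l * τ) * H (x + c * τ)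
      = c⁻¹ * Real.exp (l / c * x) * ∫ s in Ioi x, Real.exp (-(l / c) * s) * H s := by
  set F : ℝ → ℝ := fun s => Real.exp (l / c * x) * (Real.exp (-(l / c) * s) * H s) with hF
  have h1 : ∀ τ, Real.exp (-l * τ) * H (x + c * τ) = F (x + c * τ) := by
    intro τ
    simp only [hF]
    rw [← mul_assoc, ← Real.exp_add]
    congr 2
    field_simp
    ring
  simp_rw [h1]
  rw [integral_comp_mul_left_Ioi (fun y => F (x + y)) 0 hc, mul_zero, mul_assoc, ← integral_const_mul]
  rw [smul_eq_mul]
  congr 1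
  rw [← integral_indicator measurableSet_Ioi, ← integral_indicator measurableSet_Ioi,
    ← integral_add_left_eq_self ((Ioi x).indicator _) x]
  congr 1
  ext y
  simp [indicator, hF]

lemma ioi_int (hc : 0 < c) {l B : ℝ} (hl : 0 < l) {H : ℝ → ℝ} (hH : Measurable H)
    (hB : ∀ x, |H x| ≤ B) (x : ℝ) :
    IntegrableOn (fun s => Real.exp (-(l / c) * s) * H s) (Ioi x) := by
  refine Integrable.mul_bdd (c := B) (exp_neg_integrableOn_Ioi x (div_pos hl hc)) ?_
    (ae_of_all _ fun z => hB z)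
  exact hH.aestronglyMeasurable

lemma ioi_split (hc : 0 < c) {l B : ℝ} (hl : 0 < l) {H : ℝ → ℝ} (hH : Measurable H)
    (hB : ∀ x, |H x| ≤ B) (x : ℝ) :
    ∫ s in Ioi x, Real.exp (-(l / c) * s) * H s
      = (∫ s in Ioi 0, Real.exp (-(l / c) * s) * H s)
        - ∫ s in (0:ℝ)..x, Real.exp (-(l / c) * s) * H s := by
  have := intervalIntegral.integral_interval_add_Ioi (ioi_int hc hl hH hB 0) (ioi_int hc hl hH hB x)
  linarith

lemma TT_cont (S : St k χ r q M) (hc : 0 < c) {Φ : ℝ → ℝ} (h : Adm M Φ) :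
    Continuous (TT k χ r q M c Φ) := by
  have hB : ∀ x, |GG k χ r q M Φ x| ≤ lam r q M * M := fun x => by
    rw [abs_of_nonneg (GG_nonneg S h _)]; exact GG_le S h _
  have : TT k χ r q M c Φ = fun x => c⁻¹ * Real.exp (lam r q M / c * x) *
      ((∫ s in Ioi 0, Real.exp (-(lam r q M / c) * s) * GG k χ r q M Φ s)
        - ∫ s in (0:ℝ)..x, Real.exp (-(lam r q M / c) * s) * GG k χ r q M Φ s) := by
    ext x
    rw [← ioi_split hc (lam_pos S) (GG_meas S h) hB, ← ioi_form hc]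
    rfl
  rw [this]
  have h1 := intervalIntegral.continuous_primitive
    (f := fun s => Real.exp (-(lam r q M / c) * s) * GG k χ r q M Φ s) (μ := volume)
    (fun a b => (ioi_int hc (lam_pos S) (GG_meas S h) hB (min a b - 1)).mono_set (by
      intro y hy
      have := hy.1
      simp only [mem_Ioi]; linarith) |>.intervalIntegrable) 0
  fun_prop

lemma TT_der (S : St k χ r q M) (hc : 0 < c) {Φ : ℝ → ℝ} (h : Adm M Φ)
    (hG : Continuous (GG k χ r q M Φ)) (x : ℝ) :
    HasDerivAt (TT k χ r q M c Φ)
      (c⁻¹ * (lam r q M * TT k χ r q M c Φ x - GG k χ r q M Φ x)) x := by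
  have hB : ∀ x, |GG k χ r q M Φ x| ≤ lam r q M * M := fun x => by
    rw [abs_of_nonneg (GG_nonneg S h _)]; exact GG_le S h _
  have e : ∀ x, TT k χ r q M c Φ x = c⁻¹ * Real.exp (lam r q M / c * x) *
      ((∫ s in Ioi 0, Real.exp (-(lam r q M / c) * s) * GG k χ r q M Φ s)
        - ∫ s in (0:ℝ)..x, Real.exp (-(lam r q M / c) * s) * GG k χ r q M Φ s) := by
    intro x
    rw [← ioi_split hc (lam_pos S) (GG_meas S h) hB, ← ioi_form hc]
    rfl
  have h1 : Continuous fun s => Real.exp (-(lam r q M / c) * s) * GG k χ r q M Φ s := by fun_prop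
  have h2 := h1.integral_hasStrictDerivAt 0 x |>.hasDerivAt
  have h3 : HasDerivAt (fun x => c⁻¹ * Real.exp (lam r q M / c * x))
      (c⁻¹ * (Real.exp (lam r q M / c * x) * (lam r q M / c))) x := by
    have := ((hasDerivAt_id x).const_mul (lam r q M / c)).exp.const_mul c⁻¹
    simpa using this
  have h4 := h3.mul (h2.const_sub (∫ s in Ioi 0, Real.exp (-(lam r q M / c) * s) * GG k χ r q M Φ s))
  rw [e x, funext e]
  refine h4.congr_deriv ?_
  have h5 : Real.exp (lam r q M / c * x) * Real.exp (-(lam r q M / c) * x) = 1 := by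
    rw [← Real.exp_add]; simp
  generalize (∫ s in Ioi 0, Real.exp (-(lam r q M / c) * s) * GG k χ r q M Φ s) = I at *
  generalize (∫ s in (0:ℝ)..x, Real.exp (-(lam r q M / c) * s) * GG k χ r q M Φ s) = J at *
  field_simp
  have h6 : Real.exp (lam r q M * x / c) * Real.exp (-(lam r q M * x / c)) = 1 := by
    rw [← Real.exp_add]; simp
  linear_combination (-(c * GG k χ r q M Φ x)) * h6

lemma TT_zero (S : St k χ r q M) (Φ : ℝ → ℝ) (x : ℝ) :
    lam r q M * TT k χ r q M 0 Φ x = GG k χ r q M Φ x := by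
  unfold TT
  simp only [zero_mul, add_zero]
  have := lam_pos S
  rw [integral_mul_const, integral_exp_mul_Ioi (neg_lt_zero.2 this)]
  simp; field_simp

lemma Ph_low (S : St k χ r q M) (n : ℕ) (x : ℝ) :
    -(1 + q - (r + q) * χ x) / r ≤ Ph k χ r q M 0 n x := by
  have hr := S.r0
  have hs1 : -(1 + q - (r + q) * χ x) / r ≤ 1 := by
    rw [div_le_one hr]
    nlinarith [S.x1 x, S.q0]
  induction n with
  | zero => exact hs1.trans S.M1
  | succ n ih =>
    set s := -(1 + q - (r + q) * χ x) / r with hs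
    have had := Ph_adm (c := 0) S n
    rcases le_or_gt s 0 with h | h
    · exact h.trans ((Ph_adm S (n+1)).lo x)
    · have h1 := TT_zero S (Ph k χ r q M 0 n) x
      have h2 := gg_mono (x := x) S h.le ih (had.hi x)
      have h3 : lam r q M * s ≤ gg r q M χ x s := by
        have e : gg r q M χ x s = lam r q M * s + (r * s - r * χ x * s) * s := by
          simp only [gg, fH2]
          have : r * s = -(1 + q - (r + q) * χ x) := by rw [hs]; field_simp
          linear_combination (-s) * this
        have : 0 ≤ (r * s - r * χ x * s) * s := by
          have : 0 ≤ r * s * (1 - χ x) * s := by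
            have := sub_nonneg.2 (S.x1 x); positivity
          linarith
        linarith
      have h4 := Kc_nonneg S had.lo x
      have h5 : lam r q M * s ≤ lam r q M * TT k χ r q M 0 (Ph k χ r q M 0 n) x := by
        rw [h1]; unfold GG; linarith
      exact le_of_mul_le_mul_left h5 (lam_pos S)

lemma pi0_zero_or_pos (S : St k χ r q M) (hc : 0 ≤ c) :
    (∀ x, Pi0 k χ r q M c x = 0) ∨
      (∀ x, 0 < Pi0 k χ r q M c x) ∧ ∀ x, 0 < Kc k (Pi0 k χ r q M c) x := by
  set Φ := Pi0 k χ r q M c with hΦ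
  have h : Adm M Φ := Pi0_adm S
  have hfix : ∀ x, TT k χ r q M c Φ x = Φ x := Pi0_fix S
  by_cases hK : ∀ x, 0 < Kc k Φ x
  · right
    refine ⟨fun x => lt_of_le_of_ne (h.lo x) fun h0 => ?_, hK⟩
    exact (hK x).ne' (Kc_zero_of S h hfix h0.symm)
  · left
    push Not at hK
    obtain ⟨x₀, hx₀⟩ := hK
    obtain ⟨h1, h2⟩ := all_zero S h hfix (le_antisymm hx₀ (Kc_nonneg S h.lo x₀))
    rcases hc.eq_or_lt with rfl | hc
    · have hlow : ∀ x, -(1 + q - (r + q) * χ x) / r ≤ Φ x := fun x =>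
        ge_of_tendsto' (Pi0_tend S x) fun n => Ph_low S n x
      have hb : ∀ x, 0 ≤ 1 + q - (r + q) * χ x := by
        intro x
        by_contra hneg
        push Not at hneg
        have hcx := S.xc.continuous
        have hop : IsOpen {x | 1 + q - (r + q) * χ x < 0} :=
          isOpen_lt (by fun_prop) continuous_const
        obtain ⟨y, hy, hy0⟩ := ex_of_ae hop ⟨x, hneg⟩ (P := fun x => Φ x = 0)
          (by filter_upwards [h2] with y hy _ using hy)
        have := hlow y
        rw [hy0] at this
        have h3 : 0 < -(1 + q - (r + q) * χ y) / r := div_pos (neg_pos.2 hy) S.r0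
        linarith
      intro x
      have e := TT_zero S Φ x
      rw [hfix x] at e
      unfold GG at e
      rw [h1 x] at e
      have e2 : r * χ x * Φ x ^ 2 + (1 + q - (r + q) * χ x) * Φ x = 0 := by
        simp only [gg, fH2] at e
        linear_combination e
      by_contra hne
      have hpos : 0 < Φ x := lt_of_le_of_ne (h.lo x) (Ne.symm hne)
      have p1 : 0 ≤ r * χ x * Φ x ^ 2 := by
        have := S.r0; have := S.x0 x; positivity
      have p2 : 0 ≤ (1 + q - (r + q) * χ x) * Φ x := mul_nonneg (hb x) hpos.le
      have p3 : r * χ x * Φ x ^ 2 = 0 := by linarith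
      have p4 : (1 + q - (r + q) * χ x) * Φ x = 0 := by linarith
      have p5 : χ x = 0 := by
        rcases mul_eq_zero.1 p3 with h | h
        · exact (mul_eq_zero.1 h).resolve_left S.r0.ne'
        · exact absurd h (by positivity)
      rw [p5] at p4
      have := S.q0
      have : 0 < (1 + q - (r + q) * 0) * Φ x := by
        have : 0 < 1 + q - (r + q) * 0 := by linarith
        positivity
      linarith
    · intro x
      rw [← hfix x]
      unfold TT
      rw [ioi_form hc]
      have : ∫ s in Ioi x, Real.exp (-(lam r q M / c) * s) * GG k χ r q M Φ s = 0 := by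
        apply integral_eq_zero_of_ae
        refine ae_restrict_of_ae ?_
        filter_upwards [h2] with s hs
        simp [GG, h1 s, hs, gg]
      rw [this, mul_zero]

lemma pi0_zero (S : St k χ r q M) (hc : 0 ≤ c) (hno : ¬ ∃ Φ, IsTW c k (fH2 r q χ) Φ) :
    ∀ x, Pi0 k χ r q M c x = 0 := by
  rcases pi0_zero_or_pos S hc with h | ⟨hpos, hK⟩
  · exact h
  exfalso
  apply hno
  set Φ := Pi0 k χ r q M c with hΦ
  have h : Adm M Φ := Pi0_adm S
  have hfix : ∀ x, TT k χ r q M c Φ x = Φ x := Pi0_fix S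
  have hxc := S.xc
  rcases hc.eq_or_lt with rfl | hc
  · have e : ∀ x, r * χ x * Φ x ^ 2 + (1 + q - (r + q) * χ x) * Φ x = Kc k Φ x := by
      intro x
      have e := TT_zero S Φ x
      rw [hfix x] at e
      simp only [GG, gg, fH2] at e
      linear_combination e
    have hp : ∀ x, 0 < 2 * r * χ x * Φ x + (1 + q - (r + q) * χ x) := by
      intro x
      have h0 : 0 < (r * χ x * Φ x + (1 + q - (r + q) * χ x)) * Φ x := by
        linarith [e x, hK x]
      have h1 := pos_of_mul_pos_left h0 (hpos x).le
      have : 0 ≤ r * χ x * Φ x := by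
        have := S.r0; have := S.x0 x; have := hpos x; positivity
      linarith
    have hD : ∀ x, (1 + q - (r + q) * χ x) ^ 2 + 4 * r * χ x * Kc k Φ x
        = (2 * r * χ x * Φ x + (1 + q - (r + q) * χ x)) ^ 2 := by
      intro x; rw [← e x]; ring
    have hsq : ∀ x, (1 + q - (r + q) * χ x) +
        Real.sqrt ((1 + q - (r + q) * χ x) ^ 2 + 4 * r * χ x * Kc k Φ x)
        = 2 * (r * χ x * Φ x + (1 + q - (r + q) * χ x)) := by
      intro x; rw [hD x, Real.sqrt_sq (hp x).le]; ring
    have hpp : ∀ x, 0 < 2 * (r * χ x * Φ x + (1 + q - (r + q) * χ x)) := by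
      intro x
      have h0 : 0 < (r * χ x * Φ x + (1 + q - (r + q) * χ x)) * Φ x := by
        linarith [e x, hK x]
      have h1 := pos_of_mul_pos_left h0 (hpos x).le
      linarith
    have hform : Φ = fun x => 2 * Kc k Φ x / ((1 + q - (r + q) * χ x) +
        Real.sqrt ((1 + q - (r + q) * χ x) ^ 2 + 4 * r * χ x * Kc k Φ x)) := by
      ext x
      rw [hsq x, eq_div_iff (hpp x).ne', ← e x]; ring
    have hKc := Kc_contDiff S h
    have hcd : ContDiff ℝ 1 Φ := by
      rw [hform]
      have hin : ContDiff ℝ 1 fun x => (1 + q - (r + q) * χ x) ^ 2 + 4 * r * χ x * Kc k Φ x := by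
        fun_prop
      refine ContDiff.div (by fun_prop) (ContDiff.add (by fun_prop) (hin.sqrt fun x => ?_))
        fun x => ?_
      · rw [hD x]; exact (pow_pos (hp x) 2).ne'
      · rw [hsq x]; exact (hpp x).ne'
    refine ⟨Φ, hcd, hpos, ⟨M, h.hi⟩, fun x => ?_⟩
    have := e x
    unfold Kc at this
    simp only [fH2]
    linear_combination -this
  · have hcont : Continuous Φ := by
      rw [← funext hfix]; exact TT_cont S hc h
    have hG : Continuous (GG k χ r q M Φ) := by
      have h1 := (Kc_contDiff S h).continuous
      have h2 := hxc.continuous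
      unfold GG gg fH2
      fun_prop
    have hd : ∀ x, HasDerivAt Φ (c⁻¹ * (lam r q M * Φ x - GG k χ r q M Φ x)) x := by
      intro x
      have := TT_der S hc h hG x
      rwa [funext hfix] at this
    have hd' : deriv Φ = fun x => c⁻¹ * (lam r q M * Φ x - GG k χ r q M Φ x) :=
      funext fun x => (hd x).deriv
    refine ⟨Φ, ?_, hpos, ⟨M, h.hi⟩, fun x => ?_⟩
    · rw [contDiff_one_iff_deriv]
      refine ⟨fun x => (hd x).differentiableAt, ?_⟩
      rw [hd']; fun_prop
    · rw [hd']
      simp only [GG, gg, Kc]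
      field_simp
      ring

end
section
variable {k χ : ℝ → ℝ} {r q M c : ℝ} {v vt vx : ℝ → ℝ → ℝ}

def NN (r q M c : ℝ) (v vt vx : ℝ → ℝ → ℝ) (t x : ℝ) : ℝ :=
  vt (max t 0) x - c * vx (max t 0) x + lam r q M * v (max t 0) x

lemma max_cont {w : ℝ → ℝ → ℝ} (h : ContinuousOn (fun p : ℝ × ℝ => w p.1 p.2) {p : ℝ × ℝ | 0 ≤ p.1}) :
    Continuous fun p : ℝ × ℝ => w (max p.1 0) p.2 := by
  have h1 : Continuous fun p : ℝ × ℝ => ((max p.1 0, p.2) : ℝ × ℝ) := by fun_prop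
  exact h.comp_continuous h1 fun p => le_max_right p.1 0

lemma NN_cont (hs : IsClassicalSol c k (fH2 r q χ) v vt vx) :
    Continuous fun p : ℝ × ℝ => NN r q M c v vt vx p.1 p.2 := by
  obtain ⟨_, h1, h2, h3, _⟩ := hs
  exact ((max_cont h2).sub ((max_cont h3).const_mul c)).add ((max_cont h1).const_mul (lam r q M))

lemma NN_eq (hs : IsClassicalSol c k (fH2 r q χ) v vt vx) (t x : ℝ) :
    NN r q M c v vt vx t x = GG k χ r q M (v (max t 0)) x := by
  obtain ⟨_, h1, h2, h3, h4, h5, h6⟩ := hs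
  have := h6 (max t 0) x (le_max_right _ _)
  unfold NN GG gg Kc
  rw [this]; ring

lemma char_deriv (hs : IsClassicalSol c k (fH2 r q χ) v vt vx) (t y s : ℝ) (hs0 : 0 < s) :
    HasDerivAt (fun s => v s (y + c * (t - s)))
      (vt s (y + c * (t - s)) - c * vx s (y + c * (t - s))) s := by
  obtain ⟨_, h1, h2, h3, h4, h5, h6⟩ := hs
  have hev : ∀ᶠ p : ℝ × ℝ in 𝓝 (s, y + c * (t - s)), 0 < p.1 :=
    (isOpen_lt continuous_const continuous_fst).mem_nhds hs0
  have hnh : {p : ℝ × ℝ | 0 ≤ p.1} ∈ 𝓝 (s, y + c * (t - s)) := by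
    filter_upwards [hev] with p hp using hp.le
  have hT : Continuous (fun a : ℝ => ContinuousLinearMap.toSpanSingleton ℝ a) := by
    have := (ContinuousLinearMap.toSpanSingletonCLE (𝕜 := ℝ) (E := ℝ)).continuous
    exact this
  have key := hasStrictFDerivAt_uncurry_coprod (𝕜 := ℝ) (u := (s, y + c * (t - s))) (f := v)
    (f₁ := fun t x => ContinuousLinearMap.toSpanSingleton ℝ (vt t x))
    (f₂ := fun t x => ContinuousLinearMap.toSpanSingleton ℝ (vx t x))
    (by
      filter_upwards [hev] with p hp
      exact ((h4 p.1 p.2 hp.le).hasDerivAt (Ici_mem_nhds hp)).hasFDerivAt)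
    (by
      filter_upwards [hev] with p hp
      exact (h5 p.1 p.2 hp.le).hasFDerivAt)
    (hT.continuousAt.comp (h2.continuousAt hnh))
    (hT.continuousAt.comp (h3.continuousAt hnh))
  have hg : HasDerivAt (fun s : ℝ => ((s, y + c * (t - s)) : ℝ × ℝ)) (1, -c) s := by
    refine (hasDerivAt_id s).prodMk ?_
    have := (((hasDerivAt_id s).const_sub t).const_mul c).const_add y
    simpa using this
  have := key.hasFDerivAt.comp_hasDerivAt s hg
  refine this.congr_deriv ?_
  simp [Function.HasUncurry.uncurry]
  ring

lemma char_cont (hs : IsClassicalSol c k (fH2 r q χ) v vt vx) (t y : ℝ) :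
    ContinuousOn (fun s => Real.exp (lam r q M * s) * v s (y + c * (t - s))) (Ici 0) := by
  have h1 := hs.2.1
  have h2 : Continuous fun s : ℝ => ((s, y + c * (t - s)) : ℝ × ℝ) := by fun_prop
  have h3 : ContinuousOn (fun s => v s (y + c * (t - s))) (Ici 0) :=
    h1.comp h2.continuousOn fun s hs => hs
  have h4 : Continuous fun s : ℝ => Real.exp (lam r q M * s) := by fun_prop
  exact h4.continuousOn.mul h3

lemma char_deriv2 (hs : IsClassicalSol c k (fH2 r q χ) v vt vx) (t y s : ℝ) (hs0 : 0 < s) :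
    HasDerivAt (fun s => Real.exp (lam r q M * s) * v s (y + c * (t - s)))
      (Real.exp (lam r q M * s) * NN r q M c v vt vx s (y + c * (t - s))) s := by
  have h1 := char_deriv hs t y s hs0
  have h2 : HasDerivAt (fun s => Real.exp (lam r q M * s))
      (Real.exp (lam r q M * s) * lam r q M) s := by
    simpa using ((hasDerivAt_id s).const_mul (lam r q M)).exp
  refine (h2.mul h1).congr_deriv ?_
  unfold NN
  rw [max_eq_left hs0.le]
  ring

lemma duhamel (hs : IsClassicalSol c k (fH2 r q χ) v vt vx) {t : ℝ} (ht : 0 ≤ t) (y : ℝ) :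
    v t y = Real.exp (-lam r q M * t) * v 0 (y + c * t)
      + ∫ τ in (0:ℝ)..t, Real.exp (-lam r q M * τ) * NN r q M c v vt vx (t - τ) (y + c * τ) := by
  have hN := NN_cont (M := M) hs
  have hcont : Continuous fun s => Real.exp (lam r q M * s) * NN r q M c v vt vx s (y + c * (t - s)) := by
    have : Continuous fun s : ℝ => ((s, y + c * (t - s)) : ℝ × ℝ) := by fun_prop
    have h2 := hN.comp this
    exact (by fun_prop : Continuous fun s : ℝ => Real.exp (lam r q M * s)).mul h2
  have h1 := intervalIntegral.integral_eq_sub_of_hasDerivAt_of_le ht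
    ((char_cont (M := M) hs t y).mono Icc_subset_Ici_self)
    (fun s h => char_deriv2 (M := M) hs t y s h.1) (hcont.intervalIntegrable 0 t)
  have h2 := intervalIntegral.integral_comp_sub_left (a := 0) (b := t)
    (fun s => Real.exp (lam r q M * s) * NN r q M c v vt vx s (y + c * (t - s))) t
  simp only [sub_self, sub_zero, sub_sub_cancel] at h2
  rw [h1] at h2
  have h3 : ∫ τ in (0:ℝ)..t, Real.exp (-lam r q M * τ) * NN r q M c v vt vx (t - τ) (y + c * τ)
      = Real.exp (-lam r q M * t) * ∫ τ in (0:ℝ)..t, Real.exp (lam r q M * (t - τ)) *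
        NN r q M c v vt vx (t - τ) (y + c * τ) := by
    rw [← intervalIntegral.integral_const_mul]
    congr 1
    ext τ
    rw [← mul_assoc, ← Real.exp_add]
    congr 2
    ring
  rw [h3, h2]
  simp only [mul_zero, Real.exp_zero, one_mul, sub_self, add_zero, sub_zero]
  rw [mul_sub, ← mul_assoc, ← Real.exp_add]
  simp

lemma v_meas (hs : IsClassicalSol c k (fH2 r q χ) v vt vx) {t : ℝ} (ht : 0 ≤ t) : Measurable (v t) := by
  have : Continuous (v t) := continuous_iff_continuousAt.2 fun x =>
    (hs.2.2.2.2.2.1 t x ht).continuousAt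
  exact this.measurable

lemma NN_lower (S : St k χ r q M) (hs : IsClassicalSol c k (fH2 r q χ) v vt vx)
    (hM : ∀ t ξ, 0 ≤ t → |v t ξ| ≤ M) {t β : ℝ} (ht : 0 ≤ t) (hβ : 0 ≤ β)
    (h : ∀ x, -β ≤ v t x) (x : ℝ) :
    -((1 + 2 * lam r q M + 2 * r) * β) ≤ NN r q M c v vt vx t x := by
  rw [NN_eq hs, max_eq_left ht]
  have h1 : -β ≤ Kc k (v t) x := by
    rw [Kc_eq]
    calc -β = ∫ z, k z * (-β) := by rw [integral_mul_const, S.k1, one_mul]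
      _ ≤ _ := integral_mono (S.ki.mul_const _) (kint S (v_meas hs ht) (fun x => hM t x ht) x)
          fun z => mul_le_mul_of_nonneg_left (h _) (S.kn z)
  have hv := abs_le.1 (hM t x ht)
  have hr := S.r0; have hq := S.q0; have hx0 := S.x0 x; have hx1 := S.x1 x; have hM1 := S.M1
  have ha : 0 ≤ lam r q M - 1 + fH2 r q χ x (v t x) := by
    unfold lam fH2
    have : 0 ≤ (r * (1 + (M - v t x)) + q) * χ x := by
      have : 0 ≤ M - v t x := by linarith
      positivity
    have h2 : r * M * χ x ≤ r * M * 1 := by gcongr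
    nlinarith
  have hb : lam r q M - 1 + fH2 r q χ x (v t x) ≤ 2 * lam r q M + 2 * r := by
    unfold lam fH2
    have h3 : (r * (1 - v t x) + q) * χ x ≤ (r * (1 + M) + q) * 1 := by
      have : (r * (1 - v t x) + q) * χ x ≤ (r * (1 + M) + q) * χ x := by
        gcongr; linarith
      refine this.trans ?_
      gcongr
    have : 0 ≤ r * M := by positivity
    linarith
  have h2 : -((2 * lam r q M + 2 * r) * β) ≤ gg r q M χ x (v t x) := by
    unfold gg
    have e1 := mul_le_mul_of_nonneg_left (h x) ha
    have e2 := mul_le_mul_of_nonneg_right hb hβ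
    linarith
  unfold GG
  linarith

lemma v_nonneg (S : St k χ r q M) (hs : IsClassicalSol c k (fH2 r q χ) v vt vx)
    (hM : ∀ t ξ, 0 ≤ t → |v t ξ| ≤ M) (h0 : ∀ ξ, 0 ≤ v 0 ξ) {t : ℝ} (ht : 0 ≤ t) (x : ℝ) :
    0 ≤ v t x := by
  set A := 1 + 2 * lam r q M + 2 * r with hA
  have hl := lam_pos S
  have hr := S.r0
  have hM1 := S.M1
  have hApos : 0 < A := by positivity
  have key : ∀ n : ℕ, ∀ t x, 0 ≤ t → -(M * (1/2) ^ n * Real.exp (2 * A * t)) ≤ v t x := by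
    intro n
    induction n with
    | zero =>
      intro t x ht
      have := (abs_le.1 (hM t x ht)).1
      have h1 : 1 ≤ Real.exp (2 * A * t) := Real.one_le_exp (by positivity)
      simp only [pow_zero, mul_one]
      nlinarith
    | succ n ih =>
      intro t y ht
      set β := M * (1/2) ^ n with hβ
      have hβ0 : 0 ≤ β := by positivity
      have hmono : MonotoneOn (fun s => Real.exp (lam r q M * s) * v s (y + c * (t - s))
          + β / 2 * Real.exp ((lam r q M + 2 * A) * s)) (Icc 0 t) := by
        refine monotoneOn_of_hasDerivWithinAt_nonneg (convex_Icc 0 t)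
          (f' := fun s => Real.exp (lam r q M * s) * NN r q M c v vt vx s (y + c * (t - s))
            + β / 2 * (Real.exp ((lam r q M + 2 * A) * s) * (lam r q M + 2 * A))) ?_ ?_ ?_
        · refine ((char_cont (M := M) hs t y).mono Icc_subset_Ici_self).add ?_
          exact Continuous.continuousOn (by fun_prop)
        · intro s hs'
          rw [interior_Icc] at hs'
          refine HasDerivAt.hasDerivWithinAt ?_
          refine (char_deriv2 hs t y s hs'.1).add ?_
          have := (((hasDerivAt_id s).const_mul (lam r q M + 2 * A)).exp).const_mul (β / 2)
          simpa using this
        · intro s hs'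
          rw [interior_Icc] at hs'
          have h1 := NN_lower (β := β * Real.exp (2 * A * s)) S hs hM hs'.1.le (by positivity)
            (fun x => ih s x hs'.1.le) (y + c * (t - s))
          have h2 : Real.exp ((lam r q M + 2 * A) * s)
              = Real.exp (lam r q M * s) * Real.exp (2 * A * s) := by
            rw [← Real.exp_add]; congr 1; ring
          rw [h2]
          have h3 := mul_le_mul_of_nonneg_left h1 (Real.exp_pos (lam r q M * s)).le
          have h4 : 0 ≤ β / 2 * (Real.exp (lam r q M * s) * Real.exp (2 * A * s) * lam r q M) := by
            positivity
          rw [← hA] at h3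
          linarith
      have h1 := hmono ⟨le_rfl, ht⟩ ⟨ht, le_rfl⟩ ht
      simp only [mul_zero, Real.exp_zero, one_mul, sub_self, add_zero, sub_zero, mul_one] at h1
      have h2 : 0 ≤ Real.exp (lam r q M * t) * v t y + β / 2 * Real.exp ((lam r q M + 2 * A) * t) := by
        have := h0 (y + c * t)
        linarith
      have h3 : Real.exp ((lam r q M + 2 * A) * t)
          = Real.exp (lam r q M * t) * Real.exp (2 * A * t) := by
        rw [← Real.exp_add]; congr 1; ring
      rw [h3] at h2
      have h4 : 0 ≤ Real.exp (lam r q M * t) * (v t y + β / 2 * Real.exp (2 * A * t)) := by linarith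
      have h5 := nonneg_of_mul_nonneg_right h4 (Real.exp_pos _)
      rw [pow_succ]
      have : M * ((1/2)^n * (1/2)) = β / 2 := by rw [hβ]; ring
      rw [this]; linarith
  have hlim : Tendsto (fun n : ℕ => -(M * (1/2 : ℝ) ^ n * Real.exp (2 * A * t))) atTop (𝓝 0) := by
    have := ((tendsto_pow_atTop_nhds_zero_of_lt_one (r := (1/2:ℝ)) (by norm_num) (by norm_num)).const_mul M).mul_const
      (Real.exp (2 * A * t))
    simpa using this.neg
  exact le_of_tendsto' hlim fun n => key n t x ht

lemma v_adm (S : St k χ r q M) (hs : IsClassicalSol c k (fH2 r q χ) v vt vx)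
    (hM : ∀ t ξ, 0 ≤ t → |v t ξ| ≤ M) (h0 : ∀ ξ, 0 ≤ v 0 ξ) (t : ℝ) : Adm M (v (max t 0)) :=
  ⟨v_meas hs (le_max_right _ _), fun x => v_nonneg S hs hM h0 (le_max_right _ _) x,
    fun x => (abs_le.1 (hM _ x (le_max_right _ _))).2⟩

lemma max_bd {a b : ℝ} (h : 0 ≤ b) (h1 : 0 ≤ a) (ha : a ≤ M) : |max (a - b) 0| ≤ M := by
  rw [abs_of_nonneg (le_max_right _ _)]
  exact max_le (by linarith) (by linarith)

lemma NN_step (S : St k χ r q M) (hs : IsClassicalSol c k (fH2 r q χ) v vt vx)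
    (hM : ∀ t ξ, 0 ≤ t → |v t ξ| ≤ M) (h0 : ∀ ξ, 0 ≤ v 0 ξ) {φ : ℝ → ℝ} (hφ : Adm M φ)
    (hP : ∀ ξ, Tendsto (fun p : ℝ × ℝ => max (v (max p.1 0) p.2 - φ ξ) 0) (atTop ×ˢ 𝓝 ξ) (𝓝 0))
    (x : ℝ) :
    Tendsto (fun p : ℝ × ℝ => max (NN r q M c v vt vx p.1 p.2 - GG k χ r q M φ x) 0)
      (atTop ×ˢ 𝓝 x) (𝓝 0) := by
  have hva := v_adm S hs hM h0
  have hm : ∀ p : ℝ × ℝ, Measurable fun z => max (v (max p.1 0) (p.2 + z) - φ (x + z)) 0 := by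
    intro p
    have h1 := (hva p.1).me
    have h2 := hφ.me
    fun_prop
  have hI : ∀ p : ℝ × ℝ, Integrable fun z => k z * max (v (max p.1 0) (p.2 + z) - φ (x + z)) 0 := by
    intro p
    refine S.ki.mul_bdd (c := M) (hm p).aestronglyMeasurable (ae_of_all _ fun z => ?_)
    exact max_bd (hφ.lo _) ((hva p.1).lo _) ((hva p.1).hi _)
  have t1 : Tendsto (fun p : ℝ × ℝ => ∫ z, k z * max (v (max p.1 0) (p.2 + z) - φ (x + z)) 0)
      (atTop ×ˢ 𝓝 x) (𝓝 0) := by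
    have := tendsto_integral_filter_of_dominated_convergence (l := atTop ×ˢ 𝓝 x) (μ := volume)
      (F := fun (p : ℝ × ℝ) z => k z * max (v (max p.1 0) (p.2 + z) - φ (x + z)) 0)
      (f := fun _ => (0:ℝ)) (fun z => k z * M)
      (Eventually.of_forall fun p => (hI p).aestronglyMeasurable)
      (Eventually.of_forall fun p => ae_of_all _ fun z => by
        rw [norm_mul, Real.norm_eq_abs, Real.norm_eq_abs, abs_of_nonneg (S.kn z)]
        exact mul_le_mul_of_nonneg_left
          (max_bd (hφ.lo _) ((hva p.1).lo _) ((hva p.1).hi _)) (S.kn z))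
      (S.ki.mul_const M)
      (ae_of_all _ fun z => by
        have hmap : Tendsto (fun p : ℝ × ℝ => ((p.1, p.2 + z) : ℝ × ℝ)) (atTop ×ˢ 𝓝 x)
            (atTop ×ˢ 𝓝 (x + z)) := by
          refine Tendsto.prodMk tendsto_fst ?_
          exact tendsto_snd.add_const z
        have := ((hP (x + z)).comp hmap).const_mul (k z)
        simpa using this)
    simpa using this
  have t2 := (hP x).const_mul (lam r q M + r)
  have t3 : Tendsto (fun p : ℝ × ℝ => ((r * (1 + M) + q) * M) * |χ p.2 - χ x|) (atTop ×ˢ 𝓝 x) (𝓝 0) := by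
    have h1 : Tendsto (fun p : ℝ × ℝ => χ p.2) (atTop ×ˢ 𝓝 x) (𝓝 (χ x)) :=
      (S.xc.continuous.tendsto x).comp tendsto_snd
    have h2 := ((h1.sub_const (χ x)).abs).const_mul ((r * (1 + M) + q) * M)
    simpa using h2
  have t4 := (t1.add t2).add t3
  simp only [mul_zero, add_zero] at t4
  refine squeeze_zero (fun p => le_max_right _ _) (fun p => ?_) t4
  have hl := lam_pos S; have hr := S.r0; have hq := S.q0; have hM1 := S.M1
  have e1 : 0 ≤ ∫ z, k z * max (v (max p.1 0) (p.2 + z) - φ (x + z)) 0 :=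
    integral_nonneg fun z => mul_nonneg (S.kn z) (le_max_right _ _)
  have e2 : 0 ≤ (lam r q M + r) * max (v (max p.1 0) p.2 - φ x) 0 :=
    mul_nonneg (by linarith) (le_max_right _ _)
  have e3 : 0 ≤ ((r * (1 + M) + q) * M) * |χ p.2 - χ x| := by positivity
  refine max_le ?_ (by linarith)
  rw [NN_eq hs]
  unfold GG
  have f1 : Kc k (v (max p.1 0)) p.2 - Kc k φ x
      ≤ ∫ z, k z * max (v (max p.1 0) (p.2 + z) - φ (x + z)) 0 := by
    rw [Kc_eq, Kc_eq, ← integral_sub (kint S (hva p.1).me (hva p.1).ab _) (kint S hφ.me hφ.ab _)]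
    refine integral_mono ((kint S (hva p.1).me (hva p.1).ab _).sub (kint S hφ.me hφ.ab _)) (hI p)
      fun z => ?_
    simp only
    rw [← mul_sub]
    exact mul_le_mul_of_nonneg_left (le_max_left _ _) (S.kn z)
  have f2 := gg_x (x := x) (y := p.2) S ((hva p.1).lo p.2) ((hva p.1).hi p.2)
  have f3 := gg_lip (x := x) S (hφ.lo x) (hφ.hi x) ((hva p.1).lo p.2) ((hva p.1).hi p.2)
  linarith

lemma v_step (S : St k χ r q M) (hs : IsClassicalSol c k (fH2 r q χ) v vt vx)
    (hM : ∀ t ξ, 0 ≤ t → |v t ξ| ≤ M) (h0 : ∀ ξ, 0 ≤ v 0 ξ) {φ : ℝ → ℝ} (hφ : Adm M φ)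
    (hP : ∀ ξ, Tendsto (fun p : ℝ × ℝ => max (v (max p.1 0) p.2 - φ ξ) 0) (atTop ×ˢ 𝓝 ξ) (𝓝 0))
    (ξ : ℝ) :
    Tendsto (fun p : ℝ × ℝ => max (v (max p.1 0) p.2 - TT k χ r q M c φ ξ) 0)
      (atTop ×ˢ 𝓝 ξ) (𝓝 0) := by
  have hva := v_adm S hs hM h0
  have hl := lam_pos S
  have hM1 := S.M1
  have hN0 : ∀ t x, 0 ≤ NN r q M c v vt vx t x := fun t x => by
    rw [NN_eq hs]; exact GG_nonneg S (hva t) x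
  have hN1 : ∀ t x, NN r q M c v vt vx t x ≤ lam r q M * M := fun t x => by
    rw [NN_eq hs]; exact GG_le S (hva t) x
  have hNm : ∀ p : ℝ × ℝ, Measurable fun τ => NN r q M c v vt vx (p.1 - τ) (p.2 + c * τ) := by
    intro p
    have : Continuous fun τ : ℝ => ((p.1 - τ, p.2 + c * τ) : ℝ × ℝ) := by fun_prop
    exact ((NN_cont (M := M) hs).comp this).measurable
  have hNi : ∀ p : ℝ × ℝ, IntegrableOn (fun τ => Real.exp (-lam r q M * τ) *
      NN r q M c v vt vx (p.1 - τ) (p.2 + c * τ)) (Ioi (0:ℝ)) := by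
    intro p
    refine Integrable.mul_bdd (c := lam r q M * M) (exp_int S) (hNm p).aestronglyMeasurable
      (ae_of_all _ fun z => ?_)
    rw [Real.norm_eq_abs, abs_of_nonneg (hN0 _ _)]; exact hN1 _ _
  have hG := GG_meas S hφ
  have hEm : ∀ p : ℝ × ℝ, Measurable fun τ =>
      max (NN r q M c v vt vx (p.1 - τ) (p.2 + c * τ) - GG k χ r q M φ (ξ + c * τ)) 0 := by
    intro p
    have := hNm p
    fun_prop
  have hEb : ∀ (p : ℝ × ℝ) (τ : ℝ),
      |max (NN r q M c v vt vx (p.1 - τ) (p.2 + c * τ) - GG k χ r q M φ (ξ + c * τ)) 0|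
        ≤ lam r q M * M := fun p τ => max_bd (GG_nonneg S hφ _) (hN0 _ _) (hN1 _ _)
  have hEi : ∀ p : ℝ × ℝ, IntegrableOn (fun τ => Real.exp (-lam r q M * τ) *
      max (NN r q M c v vt vx (p.1 - τ) (p.2 + c * τ) - GG k χ r q M φ (ξ + c * τ)) 0)
      (Ioi (0:ℝ)) := by
    intro p
    exact Integrable.mul_bdd (c := lam r q M * M) (exp_int S) (hEm p).aestronglyMeasurable
      (ae_of_all _ fun z => hEb p z)
  have t1 : Tendsto (fun p : ℝ × ℝ => ∫ τ in Ioi (0:ℝ), Real.exp (-lam r q M * τ) *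
      max (NN r q M c v vt vx (p.1 - τ) (p.2 + c * τ) - GG k χ r q M φ (ξ + c * τ)) 0)
      (atTop ×ˢ 𝓝 ξ) (𝓝 0) := by
    have := tendsto_integral_filter_of_dominated_convergence (l := atTop ×ˢ 𝓝 ξ)
      (μ := volume.restrict (Ioi (0:ℝ)))
      (F := fun (p : ℝ × ℝ) τ => Real.exp (-lam r q M * τ) *
        max (NN r q M c v vt vx (p.1 - τ) (p.2 + c * τ) - GG k χ r q M φ (ξ + c * τ)) 0)
      (f := fun _ => (0:ℝ)) (fun τ => Real.exp (-lam r q M * τ) * (lam r q M * M))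
      (Eventually.of_forall fun p => (hEi p).aestronglyMeasurable)
      (Eventually.of_forall fun p => ae_of_all _ fun z => by
        rw [norm_mul, Real.norm_eq_abs, Real.norm_eq_abs, abs_of_nonneg (Real.exp_pos _).le]
        exact mul_le_mul_of_nonneg_left (hEb p z) (Real.exp_pos _).le)
      ((exp_int S).mul_const _)
      (ae_of_all _ fun τ => by
        have hmap : Tendsto (fun p : ℝ × ℝ => ((p.1 - τ, p.2 + c * τ) : ℝ × ℝ)) (atTop ×ˢ 𝓝 ξ)
            (atTop ×ˢ 𝓝 (ξ + c * τ)) := by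
          refine Tendsto.prodMk ?_ (tendsto_snd.add_const _)
          exact tendsto_atTop_add_const_right _ (-τ) tendsto_fst
        have := ((NN_step S hs hM h0 hφ hP (ξ + c * τ)).comp hmap).const_mul
          (Real.exp (-lam r q M * τ))
        simpa using this)
    simpa using this
  have t2 : Tendsto (fun p : ℝ × ℝ => Real.exp (-lam r q M * p.1) * M) (atTop ×ˢ 𝓝 ξ) (𝓝 0) := by
    have h1 : Tendsto (fun t : ℝ => Real.exp (-lam r q M * t)) atTop (𝓝 0) :=
      Real.tendsto_exp_atBot.comp (tendsto_id.const_mul_atTop_of_neg (neg_lt_zero.2 hl))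
    have := (h1.comp (tendsto_fst (f := atTop) (g := 𝓝 ξ))).mul_const M
    simpa using this
  have t3 := t2.add t1
  simp only [add_zero] at t3
  refine squeeze_zero' (Eventually.of_forall fun p => le_max_right _ _) ?_ t3
  have hev : ∀ᶠ p : ℝ × ℝ in atTop ×ˢ 𝓝 ξ, 0 ≤ p.1 := tendsto_fst.eventually (eventually_ge_atTop 0)
  filter_upwards [hev] with p hp
  have e0 : 0 ≤ ∫ τ in Ioi (0:ℝ), Real.exp (-lam r q M * τ) *
      max (NN r q M c v vt vx (p.1 - τ) (p.2 + c * τ) - GG k χ r q M φ (ξ + c * τ)) 0 :=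
    integral_nonneg fun z => mul_nonneg (Real.exp_pos _).le (le_max_right _ _)
  have e1 : 0 ≤ Real.exp (-lam r q M * p.1) * M := by positivity
  refine max_le ?_ (by linarith)
  rw [max_eq_left hp, duhamel (M := M) hs hp]
  have f0 : Real.exp (-lam r q M * p.1) * v 0 (p.2 + c * p.1) ≤ Real.exp (-lam r q M * p.1) * M :=
    mul_le_mul_of_nonneg_left (abs_le.1 (hM 0 _ le_rfl)).2 (Real.exp_pos _).le
  have f1 : ∫ τ in (0:ℝ)..p.1, Real.exp (-lam r q M * τ) * NN r q M c v vt vx (p.1 - τ) (p.2 + c * τ)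
      ≤ ∫ τ in Ioi (0:ℝ), Real.exp (-lam r q M * τ) * NN r q M c v vt vx (p.1 - τ) (p.2 + c * τ) := by
    rw [intervalIntegral.integral_of_le hp]
    exact setIntegral_mono_set (hNi p)
      (ae_of_all _ fun z => mul_nonneg (Real.exp_pos _).le (hN0 _ _))
      (LE.le.eventuallyLE Ioc_subset_Ioi_self)
  have f2 : (∫ τ in Ioi (0:ℝ), Real.exp (-lam r q M * τ) * NN r q M c v vt vx (p.1 - τ) (p.2 + c * τ))
      - TT k χ r q M c φ ξ ≤ ∫ τ in Ioi (0:ℝ), Real.exp (-lam r q M * τ) *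
      max (NN r q M c v vt vx (p.1 - τ) (p.2 + c * τ) - GG k χ r q M φ (ξ + c * τ)) 0 := by
    unfold TT
    rw [← integral_sub (hNi p) (TT_int S hφ ξ)]
    refine integral_mono ((hNi p).sub (TT_int S hφ ξ)) (hEi p) fun z => ?_
    simp only
    rw [← mul_sub]
    exact mul_le_mul_of_nonneg_left (le_max_left _ _) (Real.exp_pos _).le
  linarith

lemma v_all (S : St k χ r q M) (hs : IsClassicalSol c k (fH2 r q χ) v vt vx)
    (hM : ∀ t ξ, 0 ≤ t → |v t ξ| ≤ M) (h0 : ∀ ξ, 0 ≤ v 0 ξ) (n : ℕ) (ξ : ℝ) :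
    Tendsto (fun p : ℝ × ℝ => max (v (max p.1 0) p.2 - Ph k χ r q M c n ξ) 0)
      (atTop ×ˢ 𝓝 ξ) (𝓝 0) := by
  induction n generalizing ξ with
  | zero =>
    refine tendsto_const_nhds.congr fun p => ?_
    have := ((v_adm S hs hM h0) p.1).hi p.2
    rw [max_eq_right]
    change _ - M ≤ 0
    linarith
  | succ n ih => exact v_step S hs hM h0 (Ph_adm S n) ih ξ

end
/-- Extinction in the absence of traveling waves: solutions with
nonnegative initial data tend to `0` uniformly on compact sets. -/
theorem extinction_without_traveling_wave
    (k : ℝ → ℝ) (hk : H1 k) (hexp : EXPk k)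
    (r q L L0 : ℝ) (χ : ℝ → ℝ) (hχ : IsH2chi r q L L0 χ)
    (c : ℝ) (hc : 0 ≤ c)
    (hno : ¬ ∃ Φ, IsTW c k (fH2 r q χ) Φ) :
    ∀ v vt vx, IsClassicalSol c k (fH2 r q χ) v vt vx → (∀ ξ, 0 ≤ v 0 ξ) →
      ∀ K : Set ℝ, IsCompact K → ∀ ε > 0, ∃ T : ℝ, ∀ t ≥ T, ∀ ξ ∈ K, |v t ξ| < ε := by
  intro v vt vx hs h0 K hK ε hε
  obtain ⟨C, hC⟩ := hs.1
  have S : St k χ r q (max C 1) := st_of k χ r q L L0 _ hk hχ (le_max_right _ _)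
  have hM : ∀ t ξ, 0 ≤ t → |v t ξ| ≤ max C 1 := fun t ξ ht => (hC t ξ ht).trans (le_max_left _ _)
  have hz := pi0_zero S hc hno
  have hloc : ∀ ξ, ∃ U ∈ 𝓝 ξ, ∃ T : ℝ, ∀ t ≥ T, ∀ x ∈ U, |v t x| < ε := by
    intro ξ
    have h1 := Pi0_tend (c := c) S ξ
    rw [hz ξ] at h1
    obtain ⟨n, hn⟩ := (h1.eventually (gt_mem_nhds (half_pos hε))).exists
    have h2 := (v_all S hs hM h0 n ξ).eventually (gt_mem_nhds (half_pos hε))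
    rw [eventually_prod_iff] at h2
    obtain ⟨pa, ha, pb, hb, hab⟩ := h2
    obtain ⟨T, hT⟩ := eventually_atTop.1 ha
    refine ⟨{x | pb x}, hb, max T 0, fun t ht x hx => ?_⟩
    have ht0 : 0 ≤ t := (le_max_right _ _).trans ht
    have h3 := hab (hT t ((le_max_left _ _).trans ht)) hx
    simp only [max_eq_left ht0] at h3
    have h4 := (le_max_left _ _).trans_lt h3
    rw [abs_of_nonneg (v_nonneg S hs hM h0 ht0 x)]
    linarith
  refine hK.induction_on (p := fun U => ∃ T : ℝ, ∀ t ≥ T, ∀ ξ ∈ U, |v t ξ| < ε) ?_ ?_ ?_ ?_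
  · exact ⟨0, fun t _ x hx => absurd hx (notMem_empty x)⟩
  · rintro s t hst ⟨T, hT⟩
    exact ⟨T, fun τ hτ x hx => hT τ hτ x (hst hx)⟩
  · rintro s t ⟨T, hT⟩ ⟨T', hT'⟩
    refine ⟨max T T', fun τ hτ x hx => ?_⟩
    rcases hx with hx | hx
    · exact hT τ ((le_max_left _ _).trans hτ) x hx
    · exact hT' τ ((le_max_right _ _).trans hτ) x hx
  · intro x _
    obtain ⟨U, hU, T, hT⟩ := hloc x
    exact ⟨U, mem_nhdsWithin_of_mem_nhds hU, T, hT⟩
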